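/- Let $G$ be a $6$-double-critical graph that is claw-free, and let $xy \in E(G)$ with $|N(x) \cap N(y)| = 4$. Then either $G$ is isomorphic to $K_6$, or $d(x) = d(y) = 8$. -/

import Mathlib

open SimpleGraph

/-- A connected graph `G` with chromatic number `n` is `n`-double-critical if
deleting the two endpoints of any edge drops the chromatic number to `n - 2`. -/
def DoubleCritical {V : Type*} (G : SimpleGraph V) (n : ℕ) : Prop :=
  G.Connected ∧ G.chromaticNumber = (n : ℕ∞) ∧
    ∀ x y : V, G.Adj x y →
      (G.induce ({x, y}ᶜ : Set V)).chromaticNumber = ((n - 2 : ℕ) : ℕ∞)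

/-- A graph is claw-free if it has no induced `K_{1,3}`. -/
def ClawFree {V : Type*} (G : SimpleGraph V) : Prop :=
  ∀ v a b c : V, G.Adj v a → G.Adj v b → G.Adj v c →
    a ≠ b → a ≠ c → b ≠ c → ¬ G.Adj a b → ¬ G.Adj a c → ¬ G.Adj b c → False

section Coloring

variable {V : Type*} {G : SimpleGraph V}

/-- `c` is a proper `4`-coloring of `G - x - y` (with junk values at `x` and `y`). -/
def ColorsAway (G : SimpleGraph V) (c : V → Fin 4) (x y : V) : Prop :=
  ∀ u v, G.Adj u v → u ≠ x → u ≠ y → v ≠ x → v ≠ y → c u ≠ c v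

theorem ColorsAway.symm {c : V → Fin 4} {x y : V} (h : ColorsAway G c x y) :
    ColorsAway G c y x :=
  fun u v huv hux huy hvx hvy => h u v huv huy hux hvy hvx

theorem DoubleCritical.exists_colorsAway (hdc : DoubleCritical G 6) {x y : V}
    (hxy : G.Adj x y) : ∃ c, ColorsAway G c x y := by
  classical
  have hcol : (G.induce ({x, y}ᶜ : Set V)).Colorable 4 :=
    chromaticNumber_le_iff_colorable.mp (hdc.2.2 x y hxy).le
  obtain ⟨C⟩ := hcol
  refine ⟨fun v => if h : v ∈ ({x, y}ᶜ : Set V) then C ⟨v, h⟩ else 0, ?_⟩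
  intro u v huv hux huy hvx hvy
  have hu : u ∈ ({x, y}ᶜ : Set V) := by simp [hux, huy]
  have hv : v ∈ ({x, y}ᶜ : Set V) := by simp [hvx, hvy]
  simp only [hu, hv, dite_true]
  exact C.valid (by simpa using huv)

theorem DoubleCritical.not_coloring (hdc : DoubleCritical G 6) (f : V → Fin 5)
    (hf : ∀ u v, G.Adj u v → f u ≠ f v) : False := by
  have hcol : G.Colorable 5 := ⟨Coloring.mk f fun {u v} h => hf u v h⟩
  have hle := chromaticNumber_le_iff_colorable.mpr hcol
  rw [hdc.2.1] at hle
  exact absurd hle (by decide)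

/-- Every color class of `G - x - y` contains a common neighbor of `x` and `y`. -/
theorem ColorsAway.exists_common (hdc : DoubleCritical G 6) {c : V → Fin 4} {x y : V}
    (hxy : G.Adj x y) (hc : ColorsAway G c x y) (i : Fin 4) :
    ∃ v, G.Adj x v ∧ G.Adj y v ∧ c v = i := by
  classical
  by_contra! hno
  have hne := hxy.ne
  have hi : ∀ j : Fin 4, j.castSucc ≠ Fin.last 4 := fun j => (Fin.castSucc_lt_last j).ne
  have hinj : ∀ j k : Fin 4, j.castSucc = k.castSucc → j = k :=
    fun _ _ h => Fin.castSucc_injective 4 h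
  refine hdc.not_coloring (fun v => if v = x then Fin.last 4 else if v = y then i.castSucc
    else if c v = i ∧ ¬ G.Adj x v then Fin.last 4 else (c v).castSucc) ?_
  intro u v huv
  have hvu := huv.symm
  have huv' := huv.ne
  have := hc u v huv
  grind

/-- Any two distinct colors of `G - x - y` occur, in this order, on the inside of a path of
length three from `x` to `y`. -/
theorem ColorsAway.exists_path (hdc : DoubleCritical G 6) {c : V → Fin 4} {x y : V}
    (hxy : G.Adj x y) (hc : ColorsAway G c x y) {i j : Fin 4} (hij : i ≠ j) :
    ∃ u v, G.Adj x u ∧ G.Adj u v ∧ G.Adj y v ∧ u ≠ y ∧ v ≠ x ∧ c u = i ∧ c v = j := by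
  classical
  by_contra! hno
  have hne := hxy.ne
  have hi : ∀ j : Fin 4, j.castSucc ≠ Fin.last 4 := fun j => (Fin.castSucc_lt_last j).ne
  have hinj : ∀ j k : Fin 4, j.castSucc = k.castSucc → j = k :=
    fun _ _ h => Fin.castSucc_injective 4 h
  let B : V → Prop := fun v => c v = j ∧ ∃ u, G.Adj x u ∧ u ≠ y ∧ c u = i ∧ G.Adj u v
  have hBj : ∀ v, B v → c v = j := fun v h => h.1
  have hB : ∀ u v, G.Adj x u → u ≠ y → c u = i → G.Adj u v → c v = j → B v :=
    fun u v h1 h2 h3 h4 h5 => ⟨h5, u, h1, h2, h3, h4⟩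
  have hBy : ∀ v, B v → v ≠ x → ¬ G.Adj y v := by
    rintro v ⟨h5, u, h1, h2, h3, h4⟩ hvx hy
    exact hno u v h1 h4 hy h2 hvx h3 h5
  clear_value B
  refine hdc.not_coloring (fun v => if v = x then i.castSucc else if v = y then Fin.last 4
    else if c v = i ∧ G.Adj x v then j.castSucc
    else if B v then Fin.last 4 else (c v).castSucc) ?_
  intro u v huv
  have hvu := huv.symm
  have huv' := huv.ne
  have := hc u v huv
  have := hB u v
  have := hB v u
  have := hBy u
  have := hBy v
  have := hBj u
  have := hBj v
  clear hB hBy hBj hno hc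
  grind

theorem ColorsAway.card_clique_le {c : V → Fin 4} {x y : V} (hc : ColorsAway G c x y)
    {K : Finset V} (hK : G.IsClique (K : Set V)) (hx : x ∉ K) (hy : y ∉ K) : K.card ≤ 4 := by
  have hinj : Set.InjOn c (K : Set V) := by
    intro u hu v hv huv
    by_contra hne
    exact hc u v (hK hu hv hne) (by grind) (by grind) (by grind) (by grind) huv
  simpa using Finset.card_le_card_of_injOn c (t := Finset.univ) (by simp) hinj

theorem DoubleCritical.card_clique_le (hdc : DoubleCritical G 6) {K : Finset V}
    (hK : G.IsClique (K : Set V)) {x y : V} (hxy : G.Adj x y) (hx : x ∉ K) (hy : y ∉ K) :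
    K.card ≤ 4 :=
  (hdc.exists_colorsAway hxy).choose_spec.card_clique_le hK hx hy

/-- A double-critical `6`-chromatic graph containing `K₅` is `K₆`. -/
theorem DoubleCritical.iso_of_isNClique (hdc : DoubleCritical G 6) {K : Finset V}
    (hK : G.IsNClique 5 K) : Nonempty (G ≃g (⊤ : SimpleGraph (Fin 6))) := by
  classical
  by_cases hz : ∃ z, z ∉ K ∧ ∀ u ∈ K, G.Adj z u
  · obtain ⟨z, hzK, hzadj⟩ := hz
    have hK' : G.IsNClique 6 (insert z K) := hK.insert hzadj
    have huniv : ∀ u, u ∈ insert z K := by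
      by_contra! hu
      obtain ⟨u, hu⟩ := hu
      obtain ⟨p⟩ := hdc.1.preconnected z u
      obtain ⟨d, -, hd1, hd2⟩ :=
        p.exists_boundary_dart ((insert z K : Finset V) : Set V) (by simp) (by simpa using hu)
      have hle := hdc.card_clique_le (K := (insert z K).erase d.fst)
        (hK'.isClique.subset (Finset.coe_subset.2 (Finset.erase_subset _ _))) d.adj (by simp)
        (fun h => hd2 (Finset.mem_of_mem_erase h))
      rw [Finset.card_erase_of_mem (by exact_mod_cast hd1), hK'.card_eq] at hle
      omega
    have hadj : ∀ u v, u ≠ v → G.Adj u v := fun u v h =>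
      hK'.isClique (by exact_mod_cast huniv u) (by exact_mod_cast huniv v) h
    let e : V ≃ Fin 6 :=
      (Equiv.subtypeUnivEquiv huniv).symm.trans ((insert z K).equivFinOfCardEq hK'.card_eq)
    refine ⟨⟨e, ?_⟩⟩
    intro a b
    rw [top_adj, e.injective.ne_iff]
    exact ⟨hadj a b, fun h => h.ne⟩
  · push Not at hz
    exfalso
    let e : K ≃ Fin 5 := K.equivFinOfCardEq hK.card_eq
    have hg : ∀ v, ∃ u : K, (v ∈ K → v = u) ∧ (v ∉ K → ¬ G.Adj v u) := by
      intro v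
      by_cases hv : v ∈ K
      · exact ⟨⟨v, hv⟩, by simp [hv]⟩
      · obtain ⟨u, hu, huv⟩ := hz v hv
        exact ⟨⟨u, hu⟩, by simp [hv, huv]⟩
    choose g hg1 hg2 using hg
    refine hdc.not_coloring (fun v => e (g v)) ?_
    intro u v huv heq
    have hguv : (g u : V) = g v := congrArg Subtype.val (e.injective heq)
    by_cases hu : u ∈ K <;> by_cases hv : v ∈ K
    · exact huv.ne ((hg1 u hu).trans (hguv.trans (hg1 v hv).symm))
    · exact hg2 v hv (by rw [← hguv, ← hg1 u hu]; exact huv.symm)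
    · exact hg2 u hu (by rw [hguv, ← hg1 v hv]; exact huv)
    · have hle := hdc.card_clique_le hK.isClique huv hu hv
      rw [hK.card_eq] at hle
      omega

theorem SimpleGraph.CliqueFree.false_of_five (hfree : G.CliqueFree 5) {a b c d e : V}
    (hab : G.Adj a b) (hac : G.Adj a c) (had : G.Adj a d) (hae : G.Adj a e) (hbc : G.Adj b c)
    (hbd : G.Adj b d) (hbe : G.Adj b e) (hcd : G.Adj c d) (hce : G.Adj c e) (hde : G.Adj d e) :
    False := by
  classical
  have h4 : G.IsNClique 4 {b, c, d, e} := by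
    rw [show ({b, c, d, e} : Finset V) = insert b {c, d, e} from rfl]
    exact (is3Clique_triple_iff.2 ⟨hcd, hce, hde⟩).insert (by simp [hbc, hbd, hbe])
  exact hfree _ (h4.insert (a := a) (by simp [hab, hac, had, hae]))

end Coloring

section Neighborhood

variable {V : Type*} {G : SimpleGraph V}

/-- Every neighbor of `x` has at least four neighbors inside the neighborhood of `x`. -/
theorem DoubleCritical.card_nonadj_add_five_le [Fintype V] [DecidableRel G.Adj]
    (hdc : DoubleCritical G 6) {x z : V} (hxz : G.Adj x z) (S : Finset V)
    (hS : ∀ v ∈ S, G.Adj x v ∧ v ≠ z ∧ ¬ G.Adj z v) : S.card + 5 ≤ G.degree x := by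
  classical
  obtain ⟨c, hc⟩ := hdc.exists_colorsAway hxz
  choose g hgx hgz hgc using hc.exists_common hdc hxz
  have hginj : Function.Injective g := fun i j h => by rw [← hgc i, h, hgc j]
  have hdisj : Disjoint S (insert z (Finset.univ.image g)) := by
    rw [Finset.disjoint_left]
    intro v hv hv'
    obtain ⟨-, hvz, hna⟩ := hS v hv
    simp only [Finset.mem_insert, Finset.mem_image, Finset.mem_univ, true_and] at hv'
    rcases hv' with rfl | ⟨i, rfl⟩
    · exact hvz rfl
    · exact hna (hgz i)
  have hz : z ∉ Finset.univ.image g := by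
    simp only [Finset.mem_image, Finset.mem_univ, true_and, not_exists]
    exact fun i h => (hgz i).ne h.symm
  have hcard : (S ∪ insert z (Finset.univ.image g)).card = S.card + 5 := by
    rw [Finset.card_union_of_disjoint hdisj, Finset.card_insert_of_notMem hz,
      Finset.card_image_of_injective _ hginj]
    simp
  rw [← hcard, ← G.card_neighborFinset_eq_degree]
  refine Finset.card_le_card fun v hv => ?_
  rw [mem_neighborFinset]
  simp only [Finset.mem_union, Finset.mem_insert, Finset.mem_image, Finset.mem_univ,
    true_and] at hv
  rcases hv with hv | rfl | ⟨i, rfl⟩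
  · exact (hS v hv).1
  · exact hxz
  · exact hgx i

/-- The edge `xy` has exactly the four common neighbors `b i`, and `c` is a `4`-coloring of
`G - x - y` giving color `i` to `b i`. -/
structure FourCommon (G : SimpleGraph V) (x y : V) (c : V → Fin 4) (b : Fin 4 → V) : Prop where
  adj : G.Adj x y
  colors : ColorsAway G c x y
  left : ∀ i, G.Adj x (b i)
  right : ∀ i, G.Adj y (b i)
  color : ∀ i, c (b i) = i
  eq : ∀ v, G.Adj x v → G.Adj y v → v = b (c v)

theorem DoubleCritical.exists_fourCommon [Finite V] (hdc : DoubleCritical G 6)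
    {x y : V} (hxy : G.Adj x y)
    (hcard : (G.neighborSet x ∩ G.neighborSet y).ncard = 4) :
    ∃ c b, FourCommon G x y c b := by
  classical
  obtain ⟨c, hc⟩ := hdc.exists_colorsAway hxy
  choose g hgx hgy hgc using hc.exists_common hdc hxy
  have hginj : Function.Injective g := fun i j h => by rw [← hgc i, h, hgc j]
  have hrange : Set.range g = G.neighborSet x ∩ G.neighborSet y := by
    refine Set.eq_of_subset_of_ncard_le ?_ ?_ (Set.toFinite _)
    · rintro _ ⟨i, rfl⟩
      exact ⟨hgx i, hgy i⟩
    · rw [hcard, ← Set.image_univ, Set.ncard_image_of_injective _ hginj]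
      simp
  refine ⟨c, g, hxy, hc, hgx, hgy, hgc, fun v hx hy => ?_⟩
  have hv : v ∈ Set.range g := by rw [hrange]; exact ⟨hx, hy⟩
  obtain ⟨i, rfl⟩ := hv
  rw [hgc]

/-- The private neighbors of `x` with respect to `y` are the `w i`, `i ∈ T`; they form a clique,
`w i` has color `i`, and together with `y` and the `b i` they make up `N(x)`. -/
structure PrivateNeighbors [Fintype V] (G : SimpleGraph V) [DecidableRel G.Adj]
    (x y : V) (c : V → Fin 4) (b : Fin 4 → V) (T : Finset (Fin 4)) (w : Fin 4 → V) : Prop where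
  adj : ∀ i ∈ T, G.Adj x (w i)
  ne : ∀ i ∈ T, w i ≠ y
  not_adj : ∀ i ∈ T, ¬ G.Adj y (w i)
  color : ∀ i ∈ T, c (w i) = i
  clique : ∀ i ∈ T, ∀ j ∈ T, i ≠ j → G.Adj (w i) (w j)
  cover : ∀ v, G.Adj x v → v = y ∨ v = b (c v) ∨ c v ∈ T ∧ v = w (c v)
  degree : G.degree x = 5 + T.card

namespace FourCommon

variable {x y : V} {c : V → Fin 4} {b : Fin 4 → V}

theorem symm (h : FourCommon G x y c b) : FourCommon G y x c b :=
  ⟨h.adj.symm, h.colors.symm, h.right, h.left, h.color, fun v hy hx => h.eq v hx hy⟩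

theorem b_injective (h : FourCommon G x y c b) : Function.Injective b :=
  fun i j hij => by rw [← h.color i, hij, h.color j]

/-- The neighbors of `x` outside the closed neighborhood of `y` form a clique, so they have
distinct colors. -/
theorem exists_privateNeighbors [Fintype V] [DecidableRel G.Adj] (hcf : ClawFree G)
    (h : FourCommon G x y c b) : ∃ T w, PrivateNeighbors G x y c b T w := by
  classical
  let X : Finset V := Finset.univ.filter fun v => G.Adj x v ∧ v ≠ y ∧ ¬ G.Adj y v
  have hX : ∀ v, v ∈ X ↔ G.Adj x v ∧ v ≠ y ∧ ¬ G.Adj y v := fun v => by simp [X]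
  have hclique : ∀ u ∈ X, ∀ v ∈ X, u ≠ v → G.Adj u v := by
    intro u hu v hv huv
    rw [hX] at hu hv
    by_contra hna
    exact hcf x y u v h.adj hu.1 hv.1 hu.2.1.symm hv.2.1.symm huv hu.2.2 hv.2.2 hna
  have hinj : Set.InjOn c (X : Set V) := by
    intro u hu v hv huv
    by_contra hne
    have hu' := (hX u).1 hu
    have hv' := (hX v).1 hv
    exact h.colors u v (hclique u hu v hv hne) hu'.1.ne' hu'.2.1 hv'.1.ne' hv'.2.1 huv
  have hw : ∀ i, ∃ v, i ∈ X.image c → v ∈ X ∧ c v = i := by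
    intro i
    by_cases hi : i ∈ X.image c
    · obtain ⟨v, hv, hvi⟩ := Finset.mem_image.1 hi
      exact ⟨v, fun _ => ⟨hv, hvi⟩⟩
    · exact ⟨x, fun h => absurd h hi⟩
  choose w hw using hw
  have hwX : ∀ i ∈ X.image c, G.Adj x (w i) ∧ w i ≠ y ∧ ¬ G.Adj y (w i) :=
    fun i hi => (hX _).1 (hw i hi).1
  refine ⟨X.image c, w, fun i hi => (hwX i hi).1, fun i hi => (hwX i hi).2.1,
    fun i hi => (hwX i hi).2.2, fun i hi => (hw i hi).2, ?_, ?_, ?_⟩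
  · intro i hi j hj hij
    refine hclique _ (hw i hi).1 _ (hw j hj).1 fun he => hij ?_
    rw [← (hw i hi).2, he, (hw j hj).2]
  · intro v hv
    by_cases hvy : v = y
    · exact Or.inl hvy
    by_cases hyv : G.Adj y v
    · exact Or.inr (Or.inl (h.eq v hv hyv))
    · have hvX : v ∈ X := (hX v).2 ⟨hv, hvy, hyv⟩
      have hcv := Finset.mem_image_of_mem c hvX
      exact Or.inr (Or.inr ⟨hcv, hinj hvX (hw _ hcv).1 (hw _ hcv).2.symm⟩)
  · have hN : G.neighborFinset x = X ∪ insert y (Finset.univ.image b) := by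
      ext v
      simp only [mem_neighborFinset, Finset.mem_union, hX, Finset.mem_insert, Finset.mem_image,
        Finset.mem_univ, true_and]
      constructor
      · intro hv
        by_cases hvy : v = y
        · exact Or.inr (Or.inl hvy)
        by_cases hyv : G.Adj y v
        · exact Or.inr (Or.inr ⟨c v, (h.eq v hv hyv).symm⟩)
        · exact Or.inl ⟨hv, hvy, hyv⟩
      · rintro (hv | rfl | ⟨i, rfl⟩)
        · exact hv.1
        · exact h.adj
        · exact h.left i
    have hdisj : Disjoint X (insert y (Finset.univ.image b)) := by
      rw [Finset.disjoint_left]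
      intro v hv hv'
      rw [hX] at hv
      simp only [Finset.mem_insert, Finset.mem_image, Finset.mem_univ, true_and] at hv'
      rcases hv' with hv' | ⟨i, rfl⟩
      · exact hv.2.1 hv'
      · exact hv.2.2 (h.right i)
    have hy : y ∉ Finset.univ.image b := by
      simp only [Finset.mem_image, Finset.mem_univ, true_and, not_exists]
      exact fun i hi => (h.right i).ne hi.symm
    rw [← G.card_neighborFinset_eq_degree, hN, Finset.card_union_of_disjoint hdisj,
      Finset.card_insert_of_notMem hy, Finset.card_image_of_injective _ h.b_injective,
      Finset.card_image_of_injOn hinj]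
    simp
    omega

end FourCommon

namespace PrivateNeighbors

variable [Fintype V] [DecidableRel G.Adj] {x y : V} {c : V → Fin 4} {b : Fin 4 → V}
  {T : Finset (Fin 4)} {w : Fin 4 → V}

theorem ne_common (hP : PrivateNeighbors G x y c b T w) (h : FourCommon G x y c b) {i j : Fin 4}
    (hi : i ∈ T) : w i ≠ b j :=
  fun he => hP.not_adj i hi (he ▸ h.right j)

theorem not_adj_common (hP : PrivateNeighbors G x y c b T w) (h : FourCommon G x y c b)
    {i : Fin 4} (hi : i ∈ T) : ¬ G.Adj (w i) (b i) := by
  intro ha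
  refine h.colors _ _ ha (hP.adj i hi).ne' (hP.ne i hi) (h.left i).ne' (h.right i).ne' ?_
  rw [hP.color i hi, h.color]

theorem card_le_three (hfree : G.CliqueFree 5) (hP : PrivateNeighbors G x y c b T w) :
    T.card ≤ 3 := by
  by_contra! hT
  have huniv : T = Finset.univ := by
    rw [← Finset.card_eq_iff_eq_univ]
    exact le_antisymm (Finset.card_le_univ T) (by rw [Fintype.card_fin]; omega)
  subst huniv
  exact hfree.false_of_five (hP.adj 0 (by simp)) (hP.adj 1 (by simp)) (hP.adj 2 (by simp))
    (hP.adj 3 (by simp)) (hP.clique 0 (by simp) 1 (by simp) (by decide))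
    (hP.clique 0 (by simp) 2 (by simp) (by decide)) (hP.clique 0 (by simp) 3 (by simp) (by decide))
    (hP.clique 1 (by simp) 2 (by simp) (by decide)) (hP.clique 1 (by simp) 3 (by simp) (by decide))
    (hP.clique 2 (by simp) 3 (by simp) (by decide))

theorem two_le_card (hdc : DoubleCritical G 6) (hfree : G.CliqueFree 5)
    (hP : PrivateNeighbors G x y c b T w) (h : FourCommon G x y c b) : 2 ≤ T.card := by
  classical
  by_contra! hT
  have hdeg := hP.degree
  rcases T.eq_empty_or_nonempty with rfl | ⟨i, hi⟩
  · have hadj : ∀ i j, i ≠ j → G.Adj (b i) (b j) := by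
      intro i j hij
      by_contra hna
      have := hdc.card_nonadj_add_five_le (h.left i) {b j}
        (by simp [h.left, hna, h.b_injective.eq_iff, hij.symm])
      simp at this hdeg
      omega
    exact hfree.false_of_five (h.left 0) (h.left 1) (h.left 2) (h.left 3)
      (hadj 0 1 (by decide)) (hadj 0 2 (by decide)) (hadj 0 3 (by decide))
      (hadj 1 2 (by decide)) (hadj 1 3 (by decide)) (hadj 2 3 (by decide))
  · have hna := hP.not_adj_common h hi
    have hny := hP.not_adj i hi
    have := hdc.card_nonadj_add_five_le (hP.adj i hi) {y, b i} (by
      simp only [Finset.mem_insert, Finset.mem_singleton]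
      rintro v (rfl | rfl)
      · exact ⟨h.adj, (hP.ne i hi).symm, fun ha => hny ha.symm⟩
      · exact ⟨h.left i, (hP.ne_common h hi).symm, hna⟩)
    rw [Finset.card_pair (h.right i).ne] at this
    omega

/-- In a neighborhood of size seven, no vertex has three non-neighbors. -/
theorem false_of_three_nonadj (hdc : DoubleCritical G 6)
    (hP : PrivateNeighbors G x y c b T w) (hT : T.card = 2) {z u₁ u₂ u₃ : V} (hz : G.Adj x z)
    (h₁ : G.Adj x u₁) (h₂ : G.Adj x u₂) (h₃ : G.Adj x u₃) (hz₁ : u₁ ≠ z) (hz₂ : u₂ ≠ z)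
    (hz₃ : u₃ ≠ z) (h₁₂ : u₁ ≠ u₂) (h₁₃ : u₁ ≠ u₃) (h₂₃ : u₂ ≠ u₃) (hn₁ : ¬ G.Adj z u₁)
    (hn₂ : ¬ G.Adj z u₂) (hn₃ : ¬ G.Adj z u₃) : False := by
  classical
  have hdeg := hP.degree
  have := hdc.card_nonadj_add_five_le hz {u₁, u₂, u₃} (by
    simp only [Finset.mem_insert, Finset.mem_singleton]
    rintro v (rfl | rfl | rfl) <;> refine ⟨?_, ?_, ?_⟩ <;> assumption)
  rw [Finset.card_eq_three.2 ⟨u₁, u₂, u₃, h₁₂, h₁₃, h₂₃, rfl⟩] at this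
  omega

theorem adj_common_of_card_eq_two (hdc : DoubleCritical G 6)
    (hP : PrivateNeighbors G x y c b T w) (h : FourCommon G x y c b) (hT : T.card = 2)
    {i j : Fin 4} (hi : i ∈ T) (hij : i ≠ j) : G.Adj (w i) (b j) := by
  by_contra hna
  exact hP.false_of_three_nonadj hdc hT (hP.adj i hi) h.adj (h.left i) (h.left j)
    (hP.ne i hi).symm (hP.ne_common h hi).symm (hP.ne_common h hi).symm (h.right i).ne
    (h.right j).ne (h.b_injective.ne hij) (fun ha => hP.not_adj i hi ha.symm)
    (hP.not_adj_common h hi) hna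

/-- If `x` has exactly two private neighbors, then the two common neighbors with the remaining
colors are not adjacent. -/
theorem not_adj_of_card_eq_two (hdc : DoubleCritical G 6) (hfree : G.CliqueFree 5)
    (hP : PrivateNeighbors G x y c b T w) (h : FourCommon G x y c b) (hT : T.card = 2)
    {r s : Fin 4} (hr : r ∉ T) (hs : s ∉ T) : ¬ G.Adj (b r) (b s) := by
  intro hrs
  obtain ⟨p, q, hpq, rfl⟩ := Finset.card_eq_two.1 hT
  have hp : p ∈ ({p, q} : Finset (Fin 4)) := by simp
  have hq : q ∈ ({p, q} : Finset (Fin 4)) := by simp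
  exact hfree.false_of_five (hP.adj p hp) (hP.adj q hq) (h.left r) (h.left s)
    (hP.clique p hp q hq hpq)
    (hP.adj_common_of_card_eq_two hdc h hT hp fun he => hr (he ▸ hp))
    (hP.adj_common_of_card_eq_two hdc h hT hp fun he => hs (he ▸ hp))
    (hP.adj_common_of_card_eq_two hdc h hT hq fun he => hr (he ▸ hq))
    (hP.adj_common_of_card_eq_two hdc h hT hq fun he => hs (he ▸ hq)) hrs

/-- If `x` has exactly two private neighbors, then some common neighbor with one of the remaining
colors is not adjacent to some common neighbor with one of their colors. -/
theorem exists_not_adj_of_card_eq_two (hdc : DoubleCritical G 6) (hfree : G.CliqueFree 5)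
    (hP : PrivateNeighbors G x y c b T w) (h : FourCommon G x y c b) (hT : T.card = 2) :
    ∃ q ∈ T, ∃ s ∉ T, ¬ G.Adj (b s) (b q) := by
  by_contra! hall
  obtain ⟨r, s, hrs, hTc⟩ : ∃ r s, r ≠ s ∧ Tᶜ = {r, s} :=
    Finset.card_eq_two.1 (by rw [Finset.card_compl, hT]; rfl)
  have hmem : ∀ i, i ∉ T ↔ i = r ∨ i = s := by
    intro i
    rw [← Finset.mem_compl, hTc]
    simp
  have hr : r ∉ T := (hmem r).2 (Or.inl rfl)
  have hs : s ∉ T := (hmem s).2 (Or.inr rfl)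
  obtain ⟨d, hd⟩ := hdc.exists_colorsAway (h.left r)
  obtain ⟨z, hxz, hrz, hdz⟩ := hd.exists_common hdc (h.left r) (d (b s))
  have hnrs := hP.not_adj_of_card_eq_two hdc hfree h hT hr hs
  have hzs : G.Adj z (b s) := by
    rcases hP.cover z hxz with rfl | hz | ⟨hcz, hz⟩
    · exact h.right s
    · rw [hz] at hrz ⊢
      by_cases hcT : c z ∈ T
      · exact (hall _ hcT s hs).symm
      · rcases (hmem _).1 hcT with he | he
        · rw [he] at hrz
          exact absurd rfl hrz.ne
        · rw [he] at hrz
          exact absurd hrz hnrs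
    · rw [hz]
      exact hP.adj_common_of_card_eq_two hdc h hT hcz fun he => hs (he ▸ hcz)
  exact hd z (b s) hzs hxz.ne' hrz.ne' (h.left s).ne' (h.b_injective.ne hrs.symm) hdz

/-- If `b r` and `b s` are nonadjacent and no private neighbor of `x` has color `r`, then some
private neighbor of `y` has color `s`. -/
theorem mem_of_not_adj (hdc : DoubleCritical G 6) (h : FourCommon G x y c b)
    {T' : Finset (Fin 4)} {w' : Fin 4 → V} (hP : PrivateNeighbors G x y c b T w)
    (hP' : PrivateNeighbors G y x c b T' w') {r s : Fin 4} (hrs : r ≠ s) (hr : r ∉ T)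
    (hna : ¬ G.Adj (b r) (b s)) : s ∈ T' := by
  obtain ⟨u, v, hxu, huv, hyv, huy, hvx, rfl, rfl⟩ := h.colors.exists_path hdc h.adj hrs
  rcases hP.cover u hxu with hu | hu | hu
  · exact absurd hu huy
  · rcases hP'.cover v hyv with hv | hv | hv
    · exact absurd hv hvx
    · rw [← hu, ← hv] at hna
      exact absurd huv hna
    · exact hv.1
  · exact absurd hu.1 hr

/-- A private neighbor of `y` cannot share its color `p` with a private neighbor of `x` when two
nonadjacent common neighbors are both adjacent to `w p` and `b p`. -/
theorem false_of_shared_color (hcf : ClawFree G) (h : FourCommon G x y c b)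
    {T' : Finset (Fin 4)} {w' : Fin 4 → V} (hP : PrivateNeighbors G x y c b T w)
    (hP' : PrivateNeighbors G y x c b T' w') {p i j : Fin 4} (hp : p ∈ T) (hp' : p ∈ T')
    (hij : i ≠ j) (hna : ¬ G.Adj (b i) (b j)) (hiw : G.Adj (w p) (b i))
    (hjw : G.Adj (w p) (b j)) (hib : G.Adj (b p) (b i)) (hjb : G.Adj (b p) (b j)) : False := by
  have hww : w' p ≠ w p := fun he => hP.not_adj p hp (he ▸ hP'.adj p hp')
  have hnw : ¬ G.Adj (w' p) (w p) := by
    intro ha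
    refine h.colors _ _ ha (hP'.ne p hp') (hP'.adj p hp').ne' (hP.adj p hp).ne' (hP.ne p hp) ?_
    rw [hP.color p hp, hP'.color p hp']
  have hclaw : ∀ k, G.Adj (w p) (b k) → G.Adj (b p) (b k) → ¬ G.Adj (w' p) (b k) :=
    fun k hkw hkb hk => hcf (b k) (w' p) (w p) (b p) hk.symm hkw.symm hkb.symm hww
      (hP'.ne_common h.symm hp') (hP.ne_common h hp) hnw (hP'.not_adj_common h.symm hp')
      (hP.not_adj_common h hp)
  exact hcf y (w' p) (b i) (b j) (hP'.adj p hp') (h.right i) (h.right j)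
    (hP'.ne_common h.symm hp') (hP'.ne_common h.symm hp') (h.b_injective.ne hij)
    (hclaw i hiw hib) (hclaw j hjw hjb) hna

theorem card_ne_two (hdc : DoubleCritical G 6) (hfree : G.CliqueFree 5) (hcf : ClawFree G)
    (h : FourCommon G x y c b) {T' : Finset (Fin 4)} {w' : Fin 4 → V}
    (hP : PrivateNeighbors G x y c b T w) (hP' : PrivateNeighbors G y x c b T' w') :
    T.card ≠ 2 := by
  intro hT
  obtain ⟨q, hq, s, hs, hsq⟩ := hP.exists_not_adj_of_card_eq_two hdc hfree h hT
  obtain ⟨p, hp, hpq⟩ : ∃ p ∈ T, p ≠ q := Finset.exists_mem_ne (by omega) q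
  obtain ⟨r, hr, hrs⟩ : ∃ r ∈ Tᶜ, r ≠ s :=
    Finset.exists_mem_ne (by rw [Finset.card_compl, hT]; decide) s
  rw [Finset.mem_compl] at hr
  have hne : ∀ {i j}, i ∈ T → j ∉ T → i ≠ j := fun hi hj he => hj (he ▸ hi)
  have hne' : ∀ {i j}, i ≠ j → b i ≠ b j := fun hij => h.b_injective.ne hij
  have hb : ∀ {i j k}, i ≠ j → i ≠ k → j ≠ k → i ∈ T → ¬ G.Adj (b i) (b j) →
      G.Adj (b i) (b k) := by
    intro i j k hij hik hjk hi hna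
    by_contra hna'
    exact hP.false_of_three_nonadj hdc hT (h.left i) (hP.adj i hi) (h.left j) (h.left k)
      (hP.ne_common h hi) (hne' hij.symm) (hne' hik.symm) (hP.ne_common h hi)
      (hP.ne_common h hi) (hne' hjk) (fun ha => hP.not_adj_common h hi ha.symm) hna hna'
  have hw : ∀ {i j}, i ∈ T → i ≠ j → G.Adj (w i) (b j) :=
    fun hi hij => hP.adj_common_of_card_eq_two hdc h hT hi hij
  have hnrs : ¬ G.Adj (b r) (b s) := hP.not_adj_of_card_eq_two hdc hfree h hT hr hs
  have hqs : ¬ G.Adj (b q) (b s) := fun ha => hsq ha.symm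
  have hbqp : G.Adj (b q) (b p) := hb (hne hq hs) hpq.symm (hne hp hs).symm hq hqs
  have hbqr : G.Adj (b q) (b r) := hb (hne hq hs) (hne hq hr) hrs.symm hq hqs
  have hpr : ¬ G.Adj (b p) (b r) := fun ha =>
    hfree.false_of_five h.adj (h.left p) (h.left q) (h.left r) (h.right p) (h.right q)
      (h.right r) hbqp.symm ha hbqr
  have hbps : G.Adj (b p) (b s) := hb (hne hp hr) (hne hp hs) hrs hp hpr
  have hs' : s ∈ T' := hP.mem_of_not_adj hdc h hP' hrs hr hnrs
  have hr' : r ∈ T' := hP.mem_of_not_adj hdc h hP' hrs.symm hs fun ha => hnrs ha.symm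
  have hp' : p ∉ T' := fun hp' => hP.false_of_shared_color hcf h hP' hp hp' (hne hq hs) hqs
    (hw hp hpq) (hw hp (hne hp hs)) hbqp.symm hbps
  have hq' : q ∉ T' := fun hq' => hP.false_of_shared_color hcf h hP' hq hq' (hne hp hr) hpr
    (hw hq hpq.symm) (hw hq (hne hq hr)) hbqp hbqr
  have hT' : T'.card = 2 := by
    have h1 : 2 ≤ T'.card := hP'.two_le_card hdc hfree h.symm
    have h2 : 2 ≤ T'ᶜ.card := by
      rw [← Finset.card_pair hpq]
      refine Finset.card_le_card ?_
      intro i hi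
      rw [Finset.mem_insert, Finset.mem_singleton] at hi
      rcases hi with rfl | rfl <;> simpa
    rw [Finset.card_compl, Fintype.card_fin] at h2
    omega
  exact hP'.not_adj_of_card_eq_two hdc hfree h.symm hT' hq' hp' hbqp

theorem degree_eq_eight (hdc : DoubleCritical G 6) (hfree : G.CliqueFree 5) (hcf : ClawFree G)
    (h : FourCommon G x y c b) {T' : Finset (Fin 4)} {w' : Fin 4 → V}
    (hP : PrivateNeighbors G x y c b T w) (hP' : PrivateNeighbors G y x c b T' w') :
    G.degree x = 8 := by
  have h1 := hP.two_le_card hdc hfree h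
  have h2 := hP.card_le_three hfree
  have h3 := hP.card_ne_two hdc hfree hcf h hP'
  rw [hP.degree]
  omega

end PrivateNeighbors

end Neighborhood

/-- In a claw-free 6-double-critical graph, if adjacent vertices $x, y$ have
exactly 4 common neighbors, then either $G \cong K_6$ or $d(x) = d(y) = 8$. -/
theorem stmt_11 {V : Type*} [Fintype V] (G : SimpleGraph V) [DecidableRel G.Adj]
    (hdc : DoubleCritical G 6) (hcf : ClawFree G)
    (x y : V) (hxy : G.Adj x y)
    (hcard : (G.neighborSet x ∩ G.neighborSet y).ncard = 4) :
    Nonempty (G ≃g (⊤ : SimpleGraph (Fin 6))) ∨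
      (G.degree x = 8 ∧ G.degree y = 8) := by
  by_cases hfree : G.CliqueFree 5
  · right
    obtain ⟨c, b, h⟩ := hdc.exists_fourCommon hxy hcard
    obtain ⟨T, w, hP⟩ := h.exists_privateNeighbors hcf
    obtain ⟨T', w', hP'⟩ := h.symm.exists_privateNeighbors hcf
    exact ⟨hP.degree_eq_eight hdc hfree hcf h hP', hP'.degree_eq_eight hdc hfree hcf h.symm hP⟩
  · left
    obtain ⟨K, hK⟩ : ∃ K, G.IsNClique 5 K := by
      simpa [CliqueFree] using hfree
    exact hdc.iso_of_isNClique hK
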